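/- arXiv:1907.13273 — 3 statements merged into one kernel-verified Lean document; each statement's English description precedes it below -/
import Mathlib

section
/- Let α be a smooth curve in the Galilean 3-space G₃ parametrized by Galilean arc length, with Galilean Frenet frame {T, N, B}, curvature κ and torsion τ, and let φ(s,t) = α(s) + tN(s) be the normal surface along α. Then the coefficients of the second fundamental form of φ are L₁₁(s,t) = tτ'(s), L₁₂(s,t) = τ(s), and L₂₂(s,t) = 0 for all (s,t) ∈ I × ℝ. -/
noncomputable section

/-- The Galilean cross product of two vectors in `G₃` (modeled on `Fin 3 → ℝ`):
`x ∧ y = (0, x₃y₁ − x₁y₃, x₁y₂ − x₂y₁)`. -/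
def gcross (x y : Fin 3 → ℝ) : Fin 3 → ℝ :=
  ![0, x 2 * y 0 - x 0 * y 2, x 0 * y 1 - x 1 * y 0]

/-- The Galilean scalar product of two isotropic vectors: the Euclidean dot product
of their last two components. -/
def gdot (x y : Fin 3 → ℝ) : ℝ := x 1 * y 1 + x 2 * y 2

/-- The Galilean norm of an isotropic vector. -/
def gnorm (x : Fin 3 → ℝ) : ℝ := Real.sqrt (gdot x x)

/-- Partial derivative of a parametrized surface with respect to the first parameter. -/
def pderivS (φ : ℝ → ℝ → (Fin 3 → ℝ)) (s t : ℝ) : Fin 3 → ℝ :=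
  deriv (fun u => φ u t) s

/-- Partial derivative of a parametrized surface with respect to the second parameter. -/
def pderivT (φ : ℝ → ℝ → (Fin 3 → ℝ)) (s t : ℝ) : Fin 3 → ℝ :=
  deriv (fun v => φ s v) t

/-- `w = ‖φ_s ∧ φ_t‖`, the Galilean norm of the cross product of the partials. -/
def wfun (φ : ℝ → ℝ → (Fin 3 → ℝ)) (s t : ℝ) : ℝ :=
  gnorm (gcross (pderivS φ s t) (pderivT φ s t))

/-- The unit isotropic normal `η = (φ_s ∧ φ_t)/w` of the surface `φ`. -/
def unitNormal (φ : ℝ → ℝ → (Fin 3 → ℝ)) (s t : ℝ) : Fin 3 → ℝ :=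
  (wfun φ s t)⁻¹ • gcross (pderivS φ s t) (pderivT φ s t)

/-- Second fundamental form coefficient `L₁₁ = ⟨φ_ss, η⟩`. -/
def L11 (φ : ℝ → ℝ → (Fin 3 → ℝ)) (s t : ℝ) : ℝ :=
  gdot (pderivS (pderivS φ) s t) (unitNormal φ s t)

/-- Second fundamental form coefficient `L₁₂ = ⟨φ_st, η⟩`. -/
def L12 (φ : ℝ → ℝ → (Fin 3 → ℝ)) (s t : ℝ) : ℝ :=
  gdot (pderivS (pderivT φ) s t) (unitNormal φ s t)

/-- Second fundamental form coefficient `L₂₂ = ⟨φ_tt, η⟩`. -/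
def L22 (φ : ℝ → ℝ → (Fin 3 → ℝ)) (s t : ℝ) : ℝ :=
  gdot (pderivT (pderivT φ) s t) (unitNormal φ s t)

/-- Gaussian curvature `K = (L₁₁L₂₂ − L₁₂²)/w²`. -/
def Kgauss (φ : ℝ → ℝ → (Fin 3 → ℝ)) (s t : ℝ) : ℝ :=
  (L11 φ s t * L22 φ s t - (L12 φ s t) ^ 2) / (wfun φ s t) ^ 2

/-- Mean curvature of the ruled surface `φ` (with `g₁ = 1`, `g₂ = 0`): `H = L₂₂/(2w²)`. -/
def Hmean (φ : ℝ → ℝ → (Fin 3 → ℝ)) (s t : ℝ) : ℝ :=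
  L22 φ s t / (2 * (wfun φ s t) ^ 2)

/-- Adding an isotropic multiple `c • b` to `x` does not change the Galilean cross product with an
isotropic vector. -/
theorem gcross_add_smul_of_isotropic {b y : Fin 3 → ℝ} (hb : b 0 = 0) (hy : y 0 = 0)
    (x : Fin 3 → ℝ) (c : ℝ) : gcross (x + c • b) y = gcross x y := by
  simp [gcross, hb, hy]

theorem normal_surface_second_fundamental_form
    (I : Set ℝ) (hI : ∃ a b : ℝ, I = Set.Ioo a b)
    (α T N B : ℝ → (Fin 3 → ℝ)) (κ τ : ℝ → ℝ)
    (hαsm : ContDiffOn ℝ (⊤ : ℕ∞) α I) (hNsm : ContDiffOn ℝ (⊤ : ℕ∞) N I) (hBsm : ContDiffOn ℝ (⊤ : ℕ∞) B I)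
    (hκsm : ContDiffOn ℝ (⊤ : ℕ∞) κ I) (hτsm : ContDiffOn ℝ (⊤ : ℕ∞) τ I)
    (hα0 : ∀ s ∈ I, α s 0 = s)
    (hT : ∀ s ∈ I, HasDerivAt α (T s) s)
    (hNiso : ∀ s ∈ I, N s 0 = 0) (hBiso : ∀ s ∈ I, B s 0 = 0)
    (hNunit : ∀ s ∈ I, gdot (N s) (N s) = 1) (hBunit : ∀ s ∈ I, gdot (B s) (B s) = 1)
    (hNB : ∀ s ∈ I, gdot (N s) (B s) = 0)
    (hBdef : ∀ s ∈ I, B s = gcross (T s) (N s))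
    (hFrenetT : ∀ s ∈ I, HasDerivAt T (κ s • N s) s)
    (hFrenetN : ∀ s ∈ I, HasDerivAt N (τ s • B s) s)
    (hFrenetB : ∀ s ∈ I, HasDerivAt B ((-τ s) • N s) s)
    (φ : ℝ → ℝ → (Fin 3 → ℝ)) (hφ : ∀ s t : ℝ, φ s t = α s + t • N s)
    :
    ∀ s ∈ I, ∀ t : ℝ,
      L11 φ s t = t * deriv τ s ∧ L12 φ s t = τ s ∧ L22 φ s t = 0 := by
  have hIo : IsOpen I := by
    obtain ⟨a, b, rfl⟩ := hI
    exact isOpen_Ioo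
  intro s hs t
  have hφS : ∀ u ∈ I, pderivS φ u t = T u + (t * τ u) • B u := by
    intro u hu
    have h := (hT u hu).add ((hFrenetN u hu).const_smul t)
    simp only [pderivS, hφ]
    rw [smul_smul] at h
    exact h.deriv
  have hφT : ∀ u v : ℝ, pderivT φ u v = N u := by
    intro u v
    have h := ((hasDerivAt_id v).smul_const (N u)).const_add (α u)
    rw [one_smul] at h
    simp only [pderivT, hφ]
    exact h.deriv
  have hcross : gcross (pderivS φ s t) (pderivT φ s t) = B s := by
    rw [hφS s hs, hφT, gcross_add_smul_of_isotropic (hBiso s hs) (hNiso s hs), hBdef s hs]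
  have hη : unitNormal φ s t = B s := by
    simp [unitNormal, wfun, gnorm, hcross, hBunit s hs]
  have hτ : HasDerivAt τ (deriv τ s) s :=
    ((hτsm.contDiffAt (hIo.mem_nhds hs)).differentiableAt (by simp)).hasDerivAt
  have hφSS : pderivS (pderivS φ) s t =
      κ s • N s + ((t * τ s) • ((-τ s) • N s) + (t * deriv τ s) • B s) := by
    have h := (hFrenetT s hs).add ((hτ.const_mul t).smul (hFrenetB s hs))
    refine (h.congr_of_eventuallyEq ?_).deriv
    filter_upwards [hIo.mem_nhds hs] with u hu using hφS u hu
  have hφTS : pderivS (pderivT φ) s t = τ s • B s := by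
    simp only [pderivS, hφT]
    exact (hFrenetN s hs).deriv
  have hφTT : pderivT (pderivT φ) s t = 0 := by
    rw [pderivT]
    simp only [hφT, deriv_const]
  have hBB := hBunit s hs
  have hNB' := hNB s hs
  rw [L11, L12, L22, hη, hφSS, hφTS, hφTT]
  simp only [gdot, Pi.add_apply, Pi.smul_apply, Pi.zero_apply, smul_eq_mul] at hBB hNB' ⊢
  refine ⟨?_, ?_, by ring⟩
  · linear_combination (κ s - t * τ s ^ 2) * hNB' + t * deriv τ s * hBB
  · linear_combination τ s * hBB

end
end

section
/- (Lemma 3.3, case (i).) Let α be a smooth curve in the Galilean 3-space G₃ parametrized by Galilean arc length, with Galilean Frenet frame {T, N, B}, curvature κ and torsion τ, and let φ(s,t) = α(s) + tN(s) be the normal surface along α. If the Gaussian curvature of φ is a negative constant, i.e. there exists c > 0 with K(s,t) = −c for all (s,t) ∈ I × ℝ, then the torsion τ is constant on I (namely τ ≡ √c or τ ≡ −√c), so α is a curve of constant torsion (an anti-Salkowski curve when κ is non-constant). -/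
noncomputable section

theorem gcross_add_smul_left {x y z : Fin 3 → ℝ} (hy : y 0 = 0) (hz : z 0 = 0) (r : ℝ) :
    gcross (x + r • y) z = gcross x z := by
  simp [gcross, hy, hz]

section NormalSurface

variable {α N : ℝ → (Fin 3 → ℝ)} {φ : ℝ → ℝ → (Fin 3 → ℝ)}

theorem pderivT_normalSurface (hφ : ∀ s t : ℝ, φ s t = α s + t • N s) (s t : ℝ) :
    pderivT φ s t = N s := by
  have h : HasDerivAt (fun v : ℝ => α s + v • N s) ((1 : ℝ) • N s) t :=
    ((hasDerivAt_id t).smul_const (N s)).const_add (α s)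
  simpa [pderivT, hφ] using h.deriv

theorem L22_normalSurface (hφ : ∀ s t : ℝ, φ s t = α s + t • N s) (s t : ℝ) :
    L22 φ s t = 0 := by
  have h : pderivT (pderivT φ) s t = 0 := by
    rw [pderivT, funext (pderivT_normalSurface hφ s), deriv_const]
  simp [L22, h, gdot]

theorem Kgauss_normalSurface {T B : Fin 3 → ℝ} {s τ : ℝ}
    (hφ : ∀ s t : ℝ, φ s t = α s + t • N s)
    (hT : HasDerivAt α T s) (hN : HasDerivAt N (τ • B) s)
    (hNiso : N s 0 = 0) (hBiso : B 0 = 0) (hBunit : gdot B B = 1)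
    (hB : B = gcross T (N s)) (t : ℝ) :
    Kgauss φ s t = -τ ^ 2 := by
  have hs : pderivS φ s t = T + (t * τ) • B := by
    have h : HasDerivAt (fun u => φ u t) (T + t • τ • B) s := by
      simp only [hφ]
      exact hT.add (hN.const_smul t)
    rw [mul_smul]
    exact h.deriv
  have hcross : gcross (pderivS φ s t) (pderivT φ s t) = B := by
    rw [hs, pderivT_normalSurface hφ, gcross_add_smul_left hBiso hNiso, hB]
  have hw : wfun φ s t = 1 := by
    rw [wfun, hcross, gnorm, hBunit, Real.sqrt_one]
  have hη : unitNormal φ s t = B := by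
    rw [unitNormal, hw, hcross, inv_one, one_smul]
  have hst : pderivS (pderivT φ) s t = τ • B := by
    simpa only [pderivS, pderivT_normalSurface hφ] using hN.deriv
  have h12 : L12 φ s t = τ := by
    rw [L12, hst, hη]
    simp only [gdot, Pi.smul_apply, smul_eq_mul] at hBunit ⊢
    linear_combination τ * hBunit
  rw [Kgauss, L22_normalSurface hφ, h12, hw]
  ring

end NormalSurface

theorem normal_surface_constant_negative_curvature_constant_torsion
    (I : Set ℝ) (hI : ∃ a b : ℝ, I = Set.Ioo a b)
    (α T N B : ℝ → (Fin 3 → ℝ)) (κ τ : ℝ → ℝ)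
    (hαsm : ContDiffOn ℝ (⊤ : ℕ∞) α I) (hNsm : ContDiffOn ℝ (⊤ : ℕ∞) N I) (hBsm : ContDiffOn ℝ (⊤ : ℕ∞) B I)
    (hκsm : ContDiffOn ℝ (⊤ : ℕ∞) κ I) (hτsm : ContDiffOn ℝ (⊤ : ℕ∞) τ I)
    (hα0 : ∀ s ∈ I, α s 0 = s)
    (hT : ∀ s ∈ I, HasDerivAt α (T s) s)
    (hNiso : ∀ s ∈ I, N s 0 = 0) (hBiso : ∀ s ∈ I, B s 0 = 0)
    (hNunit : ∀ s ∈ I, gdot (N s) (N s) = 1) (hBunit : ∀ s ∈ I, gdot (B s) (B s) = 1)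
    (hNB : ∀ s ∈ I, gdot (N s) (B s) = 0)
    (hBdef : ∀ s ∈ I, B s = gcross (T s) (N s))
    (hFrenetT : ∀ s ∈ I, HasDerivAt T (κ s • N s) s)
    (hFrenetN : ∀ s ∈ I, HasDerivAt N (τ s • B s) s)
    (hFrenetB : ∀ s ∈ I, HasDerivAt B ((-τ s) • N s) s)
    (φ : ℝ → ℝ → (Fin 3 → ℝ)) (hφ : ∀ s t : ℝ, φ s t = α s + t • N s)
    (c : ℝ) (hc : 0 < c)
    (hK : ∀ s ∈ I, ∀ t : ℝ, Kgauss φ s t = -c) :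
    (∀ s ∈ I, τ s = Real.sqrt c) ∨ (∀ s ∈ I, τ s = -Real.sqrt c) := by
  have hsq : ∀ s ∈ I, τ s ^ 2 = √c ^ 2 := fun s hs => by
    have h := Kgauss_normalSurface hφ (hT s hs) (hFrenetN s hs) (hNiso s hs) (hBiso s hs)
      (hBunit s hs) (hBdef s hs) 0
    rw [hK s hs 0] at h
    rw [Real.sq_sqrt hc.le]
    linarith
  have hpre : IsPreconnected I := by
    obtain ⟨a, b, rfl⟩ := hI
    exact isPreconnected_Ioo
  exact hpre.eq_or_eq_neg_of_sq_eq hτsm.continuousOn continuousOn_const hsq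
    fun _ => (Real.sqrt_pos.2 hc).ne'

end
end

section
/- (Lemma 3.3, case (ii).) Let α be a smooth curve in the Galilean 3-space G₃ parametrized by Galilean arc length, with Galilean Frenet frame {T, N, B}, curvature κ and torsion τ, and let φ(s,t) = α(s) + tN(s) be the normal surface along α. If the Gaussian curvature of φ vanishes identically, K(s,t) = 0 for all (s,t) ∈ I × ℝ, then τ(s) = 0 for all s ∈ I, i.e. α is a planar curve. -/
noncomputable section

/-- Partial derivative in `t` of a surface ruled along `N`. -/
theorem pderivT_ruled (α N : ℝ → (Fin 3 → ℝ)) (s t : ℝ) :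
    pderivT (fun s t => α s + t • N s) s t = N s := by
  have h : HasDerivAt (fun v : ℝ => α s + v • N s) ((1 : ℝ) • N s) t :=
    ((hasDerivAt_id t).smul_const (N s)).const_add (α s)
  simpa [pderivT] using h.deriv

/-- Partial derivative in `s` of a surface ruled along `N`. -/
theorem pderivS_ruled {α N : ℝ → (Fin 3 → ℝ)} {s : ℝ} {a n : Fin 3 → ℝ}
    (hα : HasDerivAt α a s) (hN : HasDerivAt N n s) (t : ℝ) :
    pderivS (fun s t => α s + t • N s) s t = a + t • n :=
  (hα.add (hN.const_smul t)).deriv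

/-- Adding an isotropic vector to the first factor does not change the Galilean cross product
with an isotropic vector. -/
theorem gcross_add_isotropic (x : Fin 3 → ℝ) {y z : Fin 3 → ℝ} (hy : y 0 = 0) (hz : z 0 = 0) :
    gcross (x + z) y = gcross x y := by
  simp [gcross, hy, hz]

theorem normal_surface_flat_planar
    (I : Set ℝ) (hI : ∃ a b : ℝ, I = Set.Ioo a b)
    (α T N B : ℝ → (Fin 3 → ℝ)) (κ τ : ℝ → ℝ)
    (hαsm : ContDiffOn ℝ (⊤ : ℕ∞) α I) (hNsm : ContDiffOn ℝ (⊤ : ℕ∞) N I) (hBsm : ContDiffOn ℝ (⊤ : ℕ∞) B I)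
    (hκsm : ContDiffOn ℝ (⊤ : ℕ∞) κ I) (hτsm : ContDiffOn ℝ (⊤ : ℕ∞) τ I)
    (hα0 : ∀ s ∈ I, α s 0 = s)
    (hT : ∀ s ∈ I, HasDerivAt α (T s) s)
    (hNiso : ∀ s ∈ I, N s 0 = 0) (hBiso : ∀ s ∈ I, B s 0 = 0)
    (hNunit : ∀ s ∈ I, gdot (N s) (N s) = 1) (hBunit : ∀ s ∈ I, gdot (B s) (B s) = 1)
    (hNB : ∀ s ∈ I, gdot (N s) (B s) = 0)
    (hBdef : ∀ s ∈ I, B s = gcross (T s) (N s))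
    (hFrenetT : ∀ s ∈ I, HasDerivAt T (κ s • N s) s)
    (hFrenetN : ∀ s ∈ I, HasDerivAt N (τ s • B s) s)
    (hFrenetB : ∀ s ∈ I, HasDerivAt B ((-τ s) • N s) s)
    (φ : ℝ → ℝ → (Fin 3 → ℝ)) (hφ : ∀ s t : ℝ, φ s t = α s + t • N s)
    (hK : ∀ s ∈ I, ∀ t : ℝ, Kgauss φ s t = 0) :
    ∀ s ∈ I, τ s = 0 := by
  intro s hs
  obtain rfl : φ = fun s t => α s + t • N s := funext₂ hφ
  have hφt : pderivT (fun s t => α s + t • N s) = fun s _ => N s :=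
    funext₂ (pderivT_ruled α N)
  have hcross : gcross (pderivS (fun s t => α s + t • N s) s 0)
      (pderivT (fun s t => α s + t • N s) s 0) = B s := by
    rw [hφt, pderivS_ruled (hT s hs) (hFrenetN s hs),
      gcross_add_isotropic _ (hNiso s hs) (by simp), ← hBdef s hs]
  have hw : wfun (fun s t => α s + t • N s) s 0 = 1 := by
    rw [wfun, hcross, gnorm, hBunit s hs, Real.sqrt_one]
  have hη : unitNormal (fun s t => α s + t • N s) s 0 = B s := by
    rw [unitNormal, hw, hcross, inv_one, one_smul]
  have hL22 : L22 (fun s t => α s + t • N s) s 0 = 0 := by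
    have hφtt : pderivT (fun s (_ : ℝ) => N s) s 0 = 0 := deriv_const _ _
    rw [L22, hφt, hφtt]
    simp [gdot]
  have hL12 : L12 (fun s t => α s + t • N s) s 0 = τ s := by
    have hφst : pderivS (fun s (_ : ℝ) => N s) s 0 = τ s • B s := (hFrenetN s hs).deriv
    have hB := hBunit s hs
    rw [L12, hη, hφt, hφst]
    simp only [gdot, Pi.smul_apply, smul_eq_mul] at hB ⊢
    linear_combination τ s * hB
  simpa [Kgauss, hL22, hL12, hw] using hK s hs 0

end
end
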